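/- arXiv:1703.01283 — 9 statements merged into one kernel-verified Lean document; each statement's English description precedes it below -/
import Mathlib

section
/- (Generation theorem, group property.) Let X be a vector space over ℂ with a countable separating family of seminorms (p_j), let A : X → X be linear and strongly compatible with (p_j), and let E : ℝ → X → X be an exponential for A. Then E(0)x = x for every x ∈ X, and E(s + t)x = E(s)(E(t)x) for all s, t ∈ ℝ and x ∈ X. -/
open Filter

section ExpPartialSums

open Finset

theorem sum_square_sub_expSum_add {𝕜 M : Type*} [Field 𝕜] [CharZero 𝕜] [AddCommGroup M]
    [Module 𝕜 M] (a b : 𝕜) (v : ℕ → M) (N : ℕ) :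
    (∑ m ∈ range N, ∑ k ∈ range N, (a ^ m / m.factorial * (b ^ k / k.factorial)) • v (m + k)) -
        ∑ n ∈ range N, ((a + b) ^ n / n.factorial) • v n =
      ∑ m ∈ range N, ∑ k ∈ Ico (N - m) N,
        (a ^ m / m.factorial * (b ^ k / k.factorial)) • v (m + k) := by
  have key : ∑ n ∈ range N, ((a + b) ^ n / n.factorial) • v n =
      ∑ m ∈ range N, ∑ k ∈ range (N - m),
        (a ^ m / m.factorial * (b ^ k / k.factorial)) • v (m + k) := by
    rw [← sum_range_diag_flip N
      fun m k => (a ^ m / m.factorial * (b ^ k / k.factorial)) • v (m + k)]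
    refine sum_congr rfl fun n _ => ?_
    rw [add_pow, sum_div, sum_smul]
    refine sum_congr rfl fun m hm => ?_
    have hmn : m ≤ n := Nat.lt_succ_iff.mp (mem_range.mp hm)
    rw [Nat.add_sub_cancel' hmn, Nat.cast_choose 𝕜 hmn]
    congr 1
    have := Nat.cast_ne_zero (R := 𝕜).mpr n.factorial_ne_zero
    have := Nat.cast_ne_zero (R := 𝕜).mpr m.factorial_ne_zero
    have := Nat.cast_ne_zero (R := 𝕜).mpr (n - m).factorial_ne_zero
    field_simp
  rw [key, ← sum_sub_distrib]
  exact sum_congr rfl fun m _ => (sum_Ico_eq_sub _ (Nat.sub_le N m)).symm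

theorem tendsto_real_expSum (a : ℝ) :
    Tendsto (fun N : ℕ => ∑ n ∈ range N, a ^ n / n.factorial) atTop (nhds (Real.exp a)) := by
  rw [Real.exp_eq_exp_ℝ]
  exact (NormedSpace.expSeries_div_hasSum_exp a).tendsto_sum_nat

theorem tendsto_sum_square_sub_triangle (a b C : ℝ) :
    Tendsto (fun N : ℕ => ∑ m ∈ range N, ∑ k ∈ Ico (N - m) N,
        (a ^ m / m.factorial * (b ^ k / k.factorial)) * C ^ (m + k)) atTop (nhds 0) := by
  have h := ((tendsto_real_expSum (a * C)).mul (tendsto_real_expSum (b * C))).sub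
    (tendsto_real_expSum ((a + b) * C))
  rw [← Real.exp_add, ← add_mul, sub_self] at h
  refine h.congr fun N => ?_
  have := sum_square_sub_expSum_add a b (fun n => C ^ n) N
  simp only [smul_eq_mul] at this
  rw [← this, sum_mul_sum]
  congr 1
  · exact sum_congr rfl fun m _ => sum_congr rfl fun k _ => by ring
  · exact sum_congr rfl fun n _ => by rw [mul_pow]; ring

variable {X : Type*} [AddCommGroup X] [Module ℂ X] {q : Seminorm ℂ X} {A : X →ₗ[ℂ] X} {C : ℝ}

theorem Seminorm.map_pow_apply_le (hC : 0 ≤ C) (hA : ∀ x, q (A x) ≤ C * q x) (n : ℕ) (x : X) :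
    q ((A ^ n) x) ≤ C ^ n * q x := by
  induction n with
  | zero => simp
  | succ n ih =>
    rw [pow_succ', Module.End.mul_apply, pow_succ', mul_assoc]
    exact (hA _).trans (mul_le_mul_of_nonneg_left ih hC)

theorem Seminorm.map_expSum_le (hC : 0 ≤ C) (hA : ∀ x, q (A x) ≤ C * q x) (t : ℝ) (N : ℕ)
    (x : X) :
    q (∑ n ∈ range N, ((t : ℂ) ^ n / n.factorial) • (A ^ n) x) ≤ Real.exp (|t| * C) * q x := by
  calc
    _ ≤ ∑ n ∈ range N, q (((t : ℂ) ^ n / n.factorial) • (A ^ n) x) :=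
      le_sum_of_subadditive q (map_zero q).le (map_add_le_add q) _ _
    _ ≤ ∑ n ∈ range N, (|t| * C) ^ n / n.factorial * q x := by
      refine sum_le_sum fun n _ => ?_
      rw [map_smul_eq_mul]
      simp only [norm_div, norm_pow, Complex.norm_real, Complex.norm_natCast, Real.norm_eq_abs]
      calc
        _ ≤ |t| ^ n / n.factorial * (C ^ n * q x) := by
          gcongr
          exact Seminorm.map_pow_apply_le hC hA n x
        _ = _ := by ring
    _ ≤ _ := by
      rw [← sum_mul]
      gcongr
      exact Real.sum_le_exp_of_nonneg (by positivity) N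

theorem Seminorm.tendsto_map_expSum_comp_sub (hC : 0 ≤ C) (hA : ∀ x, q (A x) ≤ C * q x)
    (s t : ℝ) (x : X) :
    Tendsto (fun N : ℕ => q ((∑ m ∈ range N, ((s : ℂ) ^ m / m.factorial) •
        (A ^ m) (∑ k ∈ range N, ((t : ℂ) ^ k / k.factorial) • (A ^ k) x)) -
      ∑ n ∈ range N, (((s + t : ℝ) : ℂ) ^ n / n.factorial) • (A ^ n) x)) atTop (nhds 0) := by
  have hlim := (tendsto_sum_square_sub_triangle |s| |t| C).mul_const (q x)
  rw [zero_mul] at hlim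
  refine squeeze_zero (fun N => apply_nonneg q _) (fun N => ?_) hlim
  have hsq : (∑ m ∈ range N, ((s : ℂ) ^ m / m.factorial) •
        (A ^ m) (∑ k ∈ range N, ((t : ℂ) ^ k / k.factorial) • (A ^ k) x)) =
      ∑ m ∈ range N, ∑ k ∈ range N,
        ((s : ℂ) ^ m / m.factorial * ((t : ℂ) ^ k / k.factorial)) • (A ^ (m + k)) x := by
    simp only [map_sum, map_smul, smul_sum, smul_smul, pow_add, Module.End.mul_apply]
  rw [hsq, Complex.ofReal_add, sum_square_sub_expSum_add (s : ℂ) t (fun n => (A ^ n) x), sum_mul]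
  refine (le_sum_of_subadditive q (map_zero q).le (map_add_le_add q) _ _).trans
    (sum_le_sum fun m _ => ?_)
  rw [sum_mul]
  refine (le_sum_of_subadditive q (map_zero q).le (map_add_le_add q) _ _).trans
    (sum_le_sum fun k _ => ?_)
  rw [map_smul_eq_mul, mul_assoc]
  simp only [norm_mul, norm_div, norm_pow, Complex.norm_real, Complex.norm_natCast,
    Real.norm_eq_abs]
  gcongr
  exact Seminorm.map_pow_apply_le hC hA _ x

end ExpPartialSums

/-- Generation theorem, group property: if `E` is an exponential for a
strongly compatible linear map `A` on a space with a countable separating family of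
seminorms, then `E 0 x = x` and `E (s + t) x = E s (E t x)`. -/
theorem stmt_3 {X : Type*} [AddCommGroup X] [Module ℂ X]
    (p : ℕ → Seminorm ℂ X)
    (hsep : ∀ x : X, (∀ j : ℕ, p j x = 0) → x = 0)
    (A : X →ₗ[ℂ] X)
    (hA : ∀ j : ℕ, ∃ C : ℝ, 0 ≤ C ∧ ∀ x : X, p j (A x) ≤ C * p j x)
    (E : ℝ → X → X)
    (hE : ∀ (t : ℝ) (x : X) (j : ℕ),
      Tendsto (fun N : ℕ =>
          p j ((∑ n ∈ Finset.range N, ((t : ℂ) ^ n / n.factorial) • (A ^ n) x) - E t x))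
        atTop (nhds 0)) :
    (∀ x : X, E 0 x = x) ∧ ∀ (s t : ℝ) (x : X), E (s + t) x = E s (E t x) := by
  have eq_of_tendsto {y z : X} {u : ℕ → ℕ → ℝ} (hu : ∀ j, Tendsto (u j) atTop (nhds 0))
      (hle : ∀ j, ∀ᶠ N in atTop, p j (y - z) ≤ u j N) : y = z :=
    sub_eq_zero.mp <| hsep _ fun j =>
      le_antisymm (ge_of_tendsto (hu j) (hle j)) (apply_nonneg _ _)
  refine ⟨fun x => ?_, fun s t x => ?_⟩
  · refine (eq_of_tendsto (hE 0 x) fun j => ?_).symm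
    filter_upwards [eventually_ge_atTop 1] with N hN
    rw [Finset.sum_eq_single_of_mem 0 (Finset.mem_range.mpr hN)]
    · simp
    · intro n _ hn
      simp [hn]
  · choose C hC hAC using hA
    have hu (j : ℕ) := (((hE (s + t) x j).add
      (Seminorm.tendsto_map_expSum_comp_sub (hC j) (hAC j) s t x)).add
      ((hE t x j).const_mul (Real.exp (|s| * C j)))).add (hE s (E t x) j)
    simp only [mul_zero, add_zero] at hu
    refine eq_of_tendsto hu fun j => Eventually.of_forall fun N => ?_
    have hbound := Seminorm.map_expSum_le (hC j) (hAC j) s N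
      ((∑ n ∈ Finset.range N, ((t : ℂ) ^ n / n.factorial) • (A ^ n) x) - E t x)
    simp only [map_sub, smul_sub, Finset.sum_sub_distrib] at hbound
    set a := ∑ n ∈ Finset.range N, (((s + t : ℝ) : ℂ) ^ n / n.factorial) • (A ^ n) x
    set b := ∑ m ∈ Finset.range N, ((s : ℂ) ^ m / m.factorial) •
      (A ^ m) (∑ k ∈ Finset.range N, ((t : ℂ) ^ k / k.factorial) • (A ^ k) x)
    set c := ∑ n ∈ Finset.range N, ((s : ℂ) ^ n / n.factorial) • (A ^ n) (E t x)
    have htri : p j (E (s + t) x - E s (E t x)) ≤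
        p j (a - E (s + t) x) + p j (b - a) + p j (b - c) + p j (c - E s (E t x)) := by
      rw [map_sub_rev (p j) a, map_sub_rev (p j) b a]
      refine le_trans (le_of_eq ?_) ((map_add_le_add (p j) _ _).trans
        (add_le_add_left ((map_add_le_add (p j) _ _).trans
          (add_le_add_left (map_add_le_add (p j) _ _) _)) _))
      congr 1
      abel
    linarith
end

section
/- (Generation theorem, A is the infinitesimal generator.) Let X be a vector space over ℂ with a countable separating family of seminorms (p_j), let A : X → X be linear and strongly compatible with (p_j), and let E : ℝ → X → X be an exponential for A. Then for every j ∈ ℕ, every constant C ≥ 0 satisfying p_j(A x) ≤ C · p_j(x) for all x, every real t ≠ 0 and every x ∈ X, one has p_j( t⁻¹ • (E(t)x − x) − A x ) ≤ ( (exp(|t| · C) − 1)/|t| − C ) · p_j(x). In particular p_j( t⁻¹ • (E(t)x − x) − A x ) → 0 as t → 0 for every j and x. -/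
open Filter

theorem Seminorm.pow_apply_le {X : Type*} [AddCommGroup X] [Module ℂ X]
    (q : Seminorm ℂ X) (A : X →ₗ[ℂ] X) {C : ℝ} (hC : 0 ≤ C)
    (hA : ∀ x : X, q (A x) ≤ C * q x) (n : ℕ) (x : X) :
    q ((A ^ n) x) ≤ C ^ n * q x := by
  induction n with
  | zero => simp
  | succ n ih =>
    rw [pow_succ', Module.End.mul_apply, pow_succ', mul_assoc]
    exact (hA _).trans (mul_le_mul_of_nonneg_left ih hC)

theorem Seminorm.expSum_sub_le {X : Type*} [AddCommGroup X] [Module ℂ X]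
    (q : Seminorm ℂ X) (A : X →ₗ[ℂ] X) {C : ℝ} (hC : 0 ≤ C)
    (hA : ∀ x : X, q (A x) ≤ C * q x) (t : ℝ) (x : X) (N : ℕ) :
    q ((∑ n ∈ Finset.range (N + 2), ((t : ℂ) ^ n / n.factorial) • (A ^ n) x) - x - (t : ℂ) • A x)
      ≤ (Real.exp (|t| * C) - 1 - |t| * C) * q x := by
  have hsum : (∑ n ∈ Finset.range (N + 2), ((t : ℂ) ^ n / n.factorial) • (A ^ n) x) - x
      - (t : ℂ) • A x =
      ∑ n ∈ Finset.range N, ((t : ℂ) ^ (n + 2) / (n + 2).factorial) • (A ^ (n + 2)) x := by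
    rw [Finset.sum_range_succ', Finset.sum_range_succ']
    simp
  have hterm (n : ℕ) : q (((t : ℂ) ^ (n + 2) / (n + 2).factorial) • (A ^ (n + 2)) x) ≤
      (|t| * C) ^ (n + 2) / (n + 2).factorial * q x := by
    have h : ‖(t : ℂ) ^ (n + 2) / (n + 2).factorial‖ = |t| ^ (n + 2) / (n + 2).factorial := by
      simp
    rw [map_smul_eq_mul, h, mul_pow, mul_div_right_comm, mul_assoc]
    gcongr
    exact q.pow_apply_le A hC hA _ x
  have hexp : ∑ n ∈ Finset.range N, (|t| * C) ^ (n + 2) / (n + 2).factorial ≤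
      Real.exp (|t| * C) - 1 - |t| * C := by
    have h := Real.sum_le_exp_of_nonneg (x := |t| * C) (by positivity) (N + 2)
    rw [Finset.sum_range_succ', Finset.sum_range_succ'] at h
    simp only [zero_add, pow_one, pow_zero, Nat.factorial_one, Nat.factorial_zero, Nat.cast_one,
      div_one, add_assoc, Nat.reduceAdd] at h
    linarith
  rw [hsum]
  calc _ ≤ ∑ n ∈ Finset.range N, q (((t : ℂ) ^ (n + 2) / (n + 2).factorial) • (A ^ (n + 2)) x) :=
        Finset.le_sum_of_subadditive q (map_zero q).le (map_add_le_add q) _ _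
    _ ≤ ∑ n ∈ Finset.range N, (|t| * C) ^ (n + 2) / (n + 2).factorial * q x :=
        Finset.sum_le_sum fun n _ => hterm n
    _ ≤ _ := by
        rw [← Finset.sum_mul]
        exact mul_le_mul_of_nonneg_right hexp (apply_nonneg q x)

theorem tendsto_exp_abs_mul_sub_one_div (C : ℝ) :
    Tendsto (fun t : ℝ => (Real.exp (|t| * C) - 1) / |t| - C) (nhdsWithin 0 {0}ᶜ) (nhds 0) := by
  have hd : HasDerivAt (fun s : ℝ => Real.exp (s * C)) C 0 := by
    simpa using ((hasDerivAt_id (0 : ℝ)).mul_const C).exp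
  have habs : Tendsto (fun t : ℝ => |t|) (nhdsWithin 0 {0}ᶜ) (nhdsWithin 0 {0}ᶜ) := by
    refine tendsto_nhdsWithin_iff.2 ⟨?_, ?_⟩
    · exact (continuous_abs.tendsto' (0 : ℝ) 0 abs_zero).mono_left nhdsWithin_le_nhds
    · filter_upwards [self_mem_nhdsWithin] with t ht
      simpa using ht
  have h := ((hasDerivAt_iff_tendsto_slope_zero.1 hd).comp habs).sub_const C
  rw [sub_self] at h
  refine h.congr fun t => ?_
  simp [div_eq_inv_mul]

/-- Generation theorem, `A` is the infinitesimal generator: if `E` is an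
exponential for a strongly compatible linear map `A`, then for every `j`, every `C ≥ 0`
with `p j (A x) ≤ C * p j x` for all `x`, every real `t ≠ 0` and every `x`,
`p j (t⁻¹ • (E t x - x) - A x) ≤ ((exp (|t| * C) - 1)/|t| - C) * p j x`; in particular
`p j (t⁻¹ • (E t x - x) - A x) → 0` as `t → 0`. -/
theorem stmt_5 {X : Type*} [AddCommGroup X] [Module ℂ X]
    (p : ℕ → Seminorm ℂ X)
    (hsep : ∀ x : X, (∀ j : ℕ, p j x = 0) → x = 0)
    (A : X →ₗ[ℂ] X)
    (hA : ∀ j : ℕ, ∃ C : ℝ, 0 ≤ C ∧ ∀ x : X, p j (A x) ≤ C * p j x)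
    (E : ℝ → X → X)
    (hE : ∀ (t : ℝ) (x : X) (j : ℕ),
      Tendsto (fun N : ℕ =>
          p j ((∑ n ∈ Finset.range N, ((t : ℂ) ^ n / n.factorial) • (A ^ n) x) - E t x))
        atTop (nhds 0)) :
    (∀ (j : ℕ) (C : ℝ), 0 ≤ C → (∀ x : X, p j (A x) ≤ C * p j x) →
      ∀ (t : ℝ), t ≠ 0 → ∀ x : X,
        p j ((t : ℂ)⁻¹ • (E t x - x) - A x) ≤
          ((Real.exp (|t| * C) - 1) / |t| - C) * p j x) ∧
    ∀ (j : ℕ) (x : X),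
      Tendsto (fun t : ℝ => p j ((t : ℂ)⁻¹ • (E t x - x) - A x))
        (nhdsWithin 0 {0}ᶜ) (nhds 0) := by
  have bound (j : ℕ) (C : ℝ) (hC : 0 ≤ C) (hAC : ∀ x : X, p j (A x) ≤ C * p j x)
      (t : ℝ) (ht : t ≠ 0) (x : X) :
      p j ((t : ℂ)⁻¹ • (E t x - x) - A x) ≤
        ((Real.exp (|t| * C) - 1) / |t| - C) * p j x := by
    have hmain : p j (E t x - x - (t : ℂ) • A x) ≤
        (Real.exp (|t| * C) - 1 - |t| * C) * p j x := by
      have hlim := ((hE t x j).comp (tendsto_add_atTop_nat 2)).add_const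
        ((Real.exp (|t| * C) - 1 - |t| * C) * p j x)
      rw [zero_add] at hlim
      refine ge_of_tendsto' hlim fun N => ?_
      refine le_trans ?_ (add_le_add_right ((p j).expSum_sub_le A hC hAC t x N) _)
      rw [Function.comp_apply, map_sub_rev (p j) (Finset.sum _ _)]
      refine le_trans (le_of_eq ?_) (map_add_le_add (p j) _ _)
      congr 1
      abel
    have htC : (t : ℂ) ≠ 0 := by exact_mod_cast ht
    have hscale : (t : ℂ)⁻¹ • (E t x - x) - A x =
        (t : ℂ)⁻¹ • (E t x - x - (t : ℂ) • A x) := by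
      rw [smul_sub _ (E t x - x), inv_smul_smul₀ htC]
    have ht' : 0 < |t| := abs_pos.2 ht
    rw [hscale, map_smul_eq_mul, norm_inv, Complex.norm_real, Real.norm_eq_abs]
    calc |t|⁻¹ * p j (E t x - x - (t : ℂ) • A x)
        ≤ |t|⁻¹ * ((Real.exp (|t| * C) - 1 - |t| * C) * p j x) := by gcongr
      _ = _ := by field_simp
  refine ⟨bound, fun j x => ?_⟩
  obtain ⟨C, hC, hAC⟩ := hA j
  have hlim := (tendsto_exp_abs_mul_sub_one_div C).mul_const (p j x)
  rw [zero_mul] at hlim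
  refine squeeze_zero' (Eventually.of_forall fun t => apply_nonneg _ _) ?_ hlim
  filter_upwards [self_mem_nhdsWithin] with t ht
  exact bound j C hC hAC t ht x
end

section
/- (Differentiability of the generated group.) Let X be a vector space over ℂ with a countable separating family of seminorms (p_j), let A : X → X be linear and strongly compatible with (p_j), and let E : ℝ → X → X be an exponential for A. Then A(E(t)x) = E(t)(A x) for all t ∈ ℝ and x ∈ X, and for every t ∈ ℝ, x ∈ X and j ∈ ℕ, p_j( h⁻¹ • (E(t+h)x − E(t)x) − E(t)(A x) ) → 0 as h → 0 with h ≠ 0. -/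
open Filter

/-- Second-order Taylor estimate for `z ↦ z ^ (n + 1)`. -/
theorem norm_add_pow_succ_sub_le (t h : ℂ) (hh : ‖h‖ ≤ 1) (n : ℕ) :
    ‖(t + h) ^ (n + 1) - t ^ (n + 1) - (n + 1) * t ^ n * h‖
      ≤ ‖h‖ ^ 2 * (‖t‖ + 2) ^ (n + 1) := by
  have hder : ∀ n : ℕ, (n + 1) * ‖t‖ ^ n ≤ (‖t‖ + 2) ^ (n + 1) := by
    intro n
    induction n with
    | zero => simp; linarith [norm_nonneg t]
    | succ k ih =>
      have h1 : ‖t‖ ^ (k + 1) ≤ (‖t‖ + 2) ^ (k + 1) := by gcongr; linarith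
      have h2 := mul_le_mul_of_nonneg_right ih (norm_nonneg t)
      have h3 : (0 : ℝ) ≤ (‖t‖ + 2) ^ (k + 1) := by positivity
      push_cast
      calc ((k : ℝ) + 1 + 1) * ‖t‖ ^ (k + 1)
          = (k + 1) * ‖t‖ ^ k * ‖t‖ + ‖t‖ ^ (k + 1) := by ring
        _ ≤ (‖t‖ + 2) ^ (k + 1) * ‖t‖ + 2 * (‖t‖ + 2) ^ (k + 1) := by linarith
        _ = (‖t‖ + 2) ^ (k + 1 + 1) := by ring
  induction n with
  | zero => simp; positivity
  | succ k ih =>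
    have heq : (t + h) ^ (k + 1 + 1) - t ^ (k + 1 + 1) - ((k + 1 : ℕ) + 1) * t ^ (k + 1) * h
        = (t + h) * ((t + h) ^ (k + 1) - t ^ (k + 1) - (k + 1) * t ^ k * h)
          + ((k + 1 : ℕ) : ℂ) * t ^ k * h ^ 2 := by
      push_cast; ring
    have hth : ‖t + h‖ ≤ ‖t‖ + 1 := (norm_add_le _ _).trans (by linarith)
    rw [heq]
    refine (norm_add_le _ _).trans ?_
    simp only [norm_mul, norm_pow, Complex.norm_natCast]
    calc _ ≤ (‖t‖ + 1) * (‖h‖ ^ 2 * (‖t‖ + 2) ^ (k + 1))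
          + (‖t‖ + 2) ^ (k + 1) * ‖h‖ ^ 2 := by
          gcongr
          exact_mod_cast hder k
      _ = ‖h‖ ^ 2 * (‖t‖ + 2) ^ (k + 1 + 1) := by ring

section ExpPartialSum

variable {X : Type*} [AddCommGroup X] [Module ℂ X]

/-- Partial sums of the exponential series of `t • A` at `x`. -/
noncomputable def expPartialSum (A : X →ₗ[ℂ] X) (t : ℝ) (x : X) (N : ℕ) : X :=
  ∑ n ∈ Finset.range N, ((t : ℂ) ^ n / n.factorial) • (A ^ n) x

theorem map_expPartialSum (A : X →ₗ[ℂ] X) (t : ℝ) (x : X) (N : ℕ) :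
    A (expPartialSum A t x N) = expPartialSum A t (A x) N := by
  simp only [expPartialSum, map_sum, map_smul, ← Module.End.mul_apply, ← pow_succ, ← pow_succ']

theorem seminorm_pow_apply_le (q : Seminorm ℂ X) (A : X →ₗ[ℂ] X) {C : ℝ} (hC : 0 ≤ C)
    (hA : ∀ x, q (A x) ≤ C * q x) (n : ℕ) (x : X) : q ((A ^ n) x) ≤ C ^ n * q x := by
  induction n with
  | zero => simp
  | succ k ih =>
    rw [pow_succ', Module.End.mul_apply]
    calc _ ≤ C * q ((A ^ k) x) := hA _
      _ ≤ C * (C ^ k * q x) := by gcongr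
      _ = _ := by ring

theorem expPartialSum_sub_eq (A : X →ₗ[ℂ] X) (t h : ℝ) (x : X) (N : ℕ) :
    expPartialSum A (t + h) x (N + 1) - expPartialSum A t x (N + 1)
        - (h : ℂ) • expPartialSum A t (A x) N
      = ∑ n ∈ Finset.range N,
        ((((t : ℂ) + h) ^ (n + 1) - (t : ℂ) ^ (n + 1) - (n + 1) * (t : ℂ) ^ n * h)
          / (n + 1).factorial) • (A ^ (n + 1)) x := by
  simp only [expPartialSum, Finset.sum_range_succ' _ N, pow_zero, add_sub_add_right_eq_sub,
    Finset.smul_sum, ← Finset.sum_sub_distrib]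
  refine Finset.sum_congr rfl fun n _ => ?_
  rw [← Module.End.mul_apply, ← pow_succ, smul_smul, ← sub_smul, ← sub_smul]
  congr 1
  have h1 : (n.factorial : ℂ) ≠ 0 := by exact_mod_cast n.factorial_ne_zero
  have h2 : (n : ℂ) + 1 ≠ 0 := by exact_mod_cast n.succ_ne_zero
  rw [Nat.factorial_succ]
  push_cast
  field_simp

theorem seminorm_expPartialSum_sub_le (q : Seminorm ℂ X) (A : X →ₗ[ℂ] X) {C : ℝ} (hC : 0 ≤ C)
    (hA : ∀ x, q (A x) ≤ C * q x) (t h : ℝ) (hh : |h| ≤ 1) (x : X) (N : ℕ) :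
    q (expPartialSum A (t + h) x (N + 1) - expPartialSum A t x (N + 1)
        - (h : ℂ) • expPartialSum A t (A x) N)
      ≤ |h| ^ 2 * (q x * Real.exp ((|t| + 2) * C)) := by
  rw [expPartialSum_sub_eq]
  have hterm : ∀ n : ℕ,
      q (((((t : ℂ) + h) ^ (n + 1) - (t : ℂ) ^ (n + 1) - (n + 1) * (t : ℂ) ^ n * h)
          / (n + 1).factorial) • (A ^ (n + 1)) x)
        ≤ |h| ^ 2 * q x * (((|t| + 2) * C) ^ (n + 1) / (n + 1).factorial) := by
    intro n
    have hd := norm_add_pow_succ_sub_le (t : ℂ) (h : ℂ) (by simpa using hh) n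
    simp only [Complex.norm_real, Real.norm_eq_abs] at hd
    rw [map_smul_eq_mul, norm_div, Complex.norm_natCast]
    calc _ ≤ (|h| ^ 2 * (|t| + 2) ^ (n + 1)) / (n + 1).factorial * (C ^ (n + 1) * q x) := by
          gcongr
          exact seminorm_pow_apply_le q A hC hA _ _
      _ = _ := by rw [mul_pow]; ring
  have hexp := Real.sum_le_exp_of_nonneg (x := (|t| + 2) * C) (by positivity) (N + 1)
  rw [Finset.sum_range_succ'] at hexp
  calc _ ≤ ∑ n ∈ Finset.range N,
          |h| ^ 2 * q x * (((|t| + 2) * C) ^ (n + 1) / (n + 1).factorial) :=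
        (Finset.le_sum_of_subadditive q (map_zero q).le (map_add_le_add q) _ _).trans
          (Finset.sum_le_sum fun n _ => hterm n)
    _ = |h| ^ 2 * q x * ∑ n ∈ Finset.range N,
          (((|t| + 2) * C) ^ (n + 1) / (n + 1).factorial) := by rw [Finset.mul_sum]
    _ ≤ |h| ^ 2 * q x * Real.exp ((|t| + 2) * C) := by
        gcongr
        refine le_trans ?_ hexp
        simp
    _ = _ := by ring

end ExpPartialSum

/-- Differentiability of the generated group: if `E` is an exponential for
a strongly compatible linear map `A`, then `A (E t x) = E t (A x)` for all `t, x`, and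
for every `t`, `x` and `j`, `p j (h⁻¹ • (E (t+h) x - E t x) - E t (A x)) → 0` as
`h → 0`, `h ≠ 0`. -/
theorem stmt_7 {X : Type*} [AddCommGroup X] [Module ℂ X]
    (p : ℕ → Seminorm ℂ X)
    (hsep : ∀ x : X, (∀ j : ℕ, p j x = 0) → x = 0)
    (A : X →ₗ[ℂ] X)
    (hA : ∀ j : ℕ, ∃ C : ℝ, 0 ≤ C ∧ ∀ x : X, p j (A x) ≤ C * p j x)
    (E : ℝ → X → X)
    (hE : ∀ (t : ℝ) (x : X) (j : ℕ),
      Tendsto (fun N : ℕ =>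
          p j ((∑ n ∈ Finset.range N, ((t : ℂ) ^ n / n.factorial) • (A ^ n) x) - E t x))
        atTop (nhds 0)) :
    (∀ (t : ℝ) (x : X), A (E t x) = E t (A x)) ∧
    ∀ (t : ℝ) (x : X) (j : ℕ),
      Tendsto (fun h : ℝ => p j ((h : ℂ)⁻¹ • (E (t + h) x - E t x) - E t (A x)))
        (nhdsWithin 0 {0}ᶜ) (nhds 0) := by
  change ∀ t x j, Tendsto (fun N => p j (expPartialSum A t x N - E t x)) atTop (nhds 0) at hE
  refine ⟨fun t x => sub_eq_zero.mp (hsep _ fun j => ?_), fun t x j => ?_⟩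
  · obtain ⟨C, -, hC⟩ := hA j
    have hlim := ((hE t x j).const_mul C).add (hE t (A x) j)
    simp only [mul_zero, add_zero] at hlim
    refine le_antisymm (ge_of_tendsto' hlim fun N => ?_) (apply_nonneg _ _)
    calc p j (A (E t x) - E t (A x))
        = p j (expPartialSum A t (A x) N - E t (A x) - A (expPartialSum A t x N - E t x)) := by
          rw [map_sub A, map_expPartialSum]; congr 1; abel
      _ ≤ p j (expPartialSum A t (A x) N - E t (A x))
          + p j (A (expPartialSum A t x N - E t x)) := map_sub_le_add _ _ _
      _ ≤ _ := by linarith [hC (expPartialSum A t x N - E t x)]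
  obtain ⟨C, hC0, hC⟩ := hA j
  set K := p j x * Real.exp ((|t| + 2) * C)
  have hbound : ∀ h : ℝ, |h| ≤ 1 →
      p j (E (t + h) x - E t x - (h : ℂ) • E t (A x)) ≤ |h| ^ 2 * K := by
    intro h hh
    have hlim := ((((hE (t + h) x j).comp (tendsto_add_atTop_nat 1)).add
      ((hE t x j).comp (tendsto_add_atTop_nat 1))).add
        ((hE t (A x) j).const_mul |h|)).add_const (|h| ^ 2 * K)
    simp only [mul_zero, add_zero, zero_add, Function.comp_apply] at hlim
    refine ge_of_tendsto' hlim fun N => ?_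
    set u := expPartialSum A (t + h) x (N + 1)
    set v := expPartialSum A t x (N + 1)
    set w := expPartialSum A t (A x) N
    have hS : p j (u - v - (h : ℂ) • w) ≤ |h| ^ 2 * K :=
      seminorm_expPartialSum_sub_le (p j) A hC0 hC t h hh x N
    have heq : E (t + h) x - E t x - (h : ℂ) • E t (A x)
        = (v - E t x) - (u - E (t + h) x) + (h : ℂ) • (w - E t (A x))
          + (u - v - (h : ℂ) • w) := by
      rw [smul_sub]; abel
    have h1 := map_add_le_add (p j) ((v - E t x) - (u - E (t + h) x)
      + (h : ℂ) • (w - E t (A x))) (u - v - (h : ℂ) • w)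
    have h2 := map_add_le_add (p j) ((v - E t x) - (u - E (t + h) x)) ((h : ℂ) • (w - E t (A x)))
    have h3 := map_sub_le_add (p j) (v - E t x) (u - E (t + h) x)
    rw [map_smul_eq_mul, Complex.norm_real, Real.norm_eq_abs] at h2
    rw [heq]
    linarith
  have hlim : Tendsto (fun h : ℝ => |h| * K) (nhdsWithin 0 {0}ᶜ) (nhds 0) := by
    have hcont : Continuous fun h : ℝ => |h| * K := by fun_prop
    simpa using (hcont.tendsto 0).mono_left nhdsWithin_le_nhds
  refine squeeze_zero' (.of_forall fun _ => apply_nonneg _ _) ?_ hlim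
  filter_upwards [self_mem_nhdsWithin,
    nhdsWithin_le_nhds (Metric.closedBall_mem_nhds (0 : ℝ) one_pos)] with h h0 h1
  have h0 : h ≠ 0 := h0
  have h1 : |h| ≤ 1 := by simpa using h1
  have hc : (h : ℂ) ≠ 0 := by exact_mod_cast h0
  have heq : (h : ℂ)⁻¹ • (E (t + h) x - E t x) - E t (A x)
      = (h : ℂ)⁻¹ • (E (t + h) x - E t x - (h : ℂ) • E t (A x)) := by
    rw [smul_sub _ _ ((h : ℂ) • _), inv_smul_smul₀ hc]
  rw [heq, map_smul_eq_mul, norm_inv, Complex.norm_real, Real.norm_eq_abs,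
    inv_mul_le_iff₀ (abs_pos.mpr h0)]
  exact (hbound h h1).trans_eq (by ring)
end

section
/- (Uniqueness of uniformly continuous groups with a common generator.) Let X be a vector space over ℂ with a countable separating family of seminorms (p_j). Let T, S : ℝ → (X →ₗ[ℂ] X) satisfy: T(0) = id and S(0) = id; T(s+t) = T(s) ∘ T(t) and S(s+t) = S(s) ∘ S(t) for all s, t ∈ ℝ; for every j ∈ ℕ and every τ > 0 there is a constant c ≥ 0 such that p_j(T(t)x) ≤ c · p_j(x) and p_j(S(t)x) ≤ c · p_j(x) for all |t| ≤ τ and all x ∈ X; and for every j ∈ ℕ and ε > 0 there is δ > 0 such that p_j(T(h)x − S(h)x) ≤ ε · |h| · p_j(x) for all 0 < |h| ≤ δ and all x ∈ X. Then T(t) = S(t) for every t ∈ ℝ. -/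
/-- Telescoping estimate: if two one-parameter semigroups of linear maps are bounded by `c` on
`[-|t|, |t|]` and their difference at time `h = t / n` is bounded by `d`, then their difference at
time `t` is bounded by `n * (c * (d * c))`. -/
theorem seminorm_sub_le_of_step {X : Type*} [AddCommGroup X] [Module ℂ X]
    (q : Seminorm ℂ X) (T S : ℝ → (X →ₗ[ℂ] X)) (hT0 : T 0 = LinearMap.id)
    (hS0 : S 0 = LinearMap.id)
    (hTadd : ∀ s t : ℝ, T (s + t) = (T s).comp (T t))
    (hSadd : ∀ s t : ℝ, S (s + t) = (S s).comp (S t))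
    {t h c d : ℝ} {n : ℕ} (hn : n * h = t) (hc : 0 ≤ c) (hd : 0 ≤ d)
    (hbound : ∀ s : ℝ, |s| ≤ |t| → ∀ x : X, q (T s x) ≤ c * q x ∧ q (S s x) ≤ c * q x)
    (hstep : ∀ x : X, q (T h x - S h x) ≤ d * q x) (x : X) :
    q (T t x - S t x) ≤ n * (c * (d * (c * q x))) := by
  have abs_le : ∀ k : ℕ, k ≤ n → |k * h| ≤ |t| := by
    intro k hk
    rw [← hn, abs_mul, abs_mul, Nat.abs_cast, Nat.abs_cast]
    gcongr
  have telescope : ∀ k : ℕ, k ≤ n →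
      q (T (k * h) (S (t - k * h) x) - S t x) ≤ k * (c * (d * (c * q x))) := by
    intro k
    induction k with
    | zero => intro _; simp [hT0]
    | succ k ih =>
      intro hk
      have hrem : t - (k + 1 : ℕ) * h = (n - (k + 1) : ℕ) * h := by
        rw [Nat.cast_sub hk, ← hn]; ring
      set y := S (t - (k + 1 : ℕ) * h) x with hy
      have hTsplit : T ((k + 1 : ℕ) * h) y = T (k * h) (T h y) := by
        rw [show ((k + 1 : ℕ) : ℝ) * h = k * h + h by push_cast; ring, hTadd]; rfl
      have hSsplit : S (t - k * h) x = S h y := by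
        rw [show t - k * h = h + (t - (k + 1 : ℕ) * h) by push_cast; ring, hSadd]; rfl
      have hdecomp : T ((k + 1 : ℕ) * h) y - S t x =
          T (k * h) (T h y - S h y) + (T (k * h) (S (t - k * h) x) - S t x) := by
        rw [hTsplit, hSsplit, map_sub]; abel
      have hincr : q (T (k * h) (T h y - S h y)) ≤ c * (d * (c * q x)) := by
        refine ((hbound _ (abs_le k (by omega)) _).1).trans ?_
        gcongr
        refine (hstep y).trans ?_
        gcongr
        refine (hbound _ ?_ x).2
        rw [hrem]
        exact abs_le _ (Nat.sub_le _ _)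
      rw [hdecomp]
      refine (map_add_le_add q _ _).trans ((add_le_add hincr (ih (by omega))).trans_eq ?_)
      push_cast
      ring
  simpa [hn, hS0] using telescope n le_rfl


/-- Uniqueness of uniformly continuous groups with a common generator:
two groups `T, S : ℝ → (X →ₗ[ℂ] X)` which are locally uniformly bounded in every
seminorm and whose difference at time `h` is `o(|h|)` uniformly in every seminorm
coincide for every `t`. -/
theorem stmt_8 {X : Type*} [AddCommGroup X] [Module ℂ X]
    (p : ℕ → Seminorm ℂ X)
    (hsep : ∀ x : X, (∀ j : ℕ, p j x = 0) → x = 0)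
    (T S : ℝ → (X →ₗ[ℂ] X))
    (hT0 : T 0 = LinearMap.id) (hS0 : S 0 = LinearMap.id)
    (hTadd : ∀ s t : ℝ, T (s + t) = (T s).comp (T t))
    (hSadd : ∀ s t : ℝ, S (s + t) = (S s).comp (S t))
    (hbound : ∀ (j : ℕ) (τ : ℝ), 0 < τ → ∃ c : ℝ, 0 ≤ c ∧
      ∀ t : ℝ, |t| ≤ τ → ∀ x : X, p j (T t x) ≤ c * p j x ∧ p j (S t x) ≤ c * p j x)
    (hclose : ∀ (j : ℕ) (ε : ℝ), 0 < ε → ∃ δ : ℝ, 0 < δ ∧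
      ∀ h : ℝ, 0 < |h| → |h| ≤ δ → ∀ x : X, p j (T h x - S h x) ≤ ε * |h| * p j x) :
    ∀ t : ℝ, T t = S t := by
  intro t
  rcases eq_or_ne t 0 with rfl | ht
  · rw [hT0, hS0]
  have htpos : 0 < |t| := abs_pos.mpr ht
  ext x
  rw [← sub_eq_zero]
  refine hsep _ fun j => le_antisymm ?_ (apply_nonneg _ _)
  obtain ⟨c, hc, hcb⟩ := hbound j |t| htpos
  set K := |t| * (c * (c * p j x)) with hK
  have hK0 : 0 ≤ K := by positivity
  have small : ∀ ε : ℝ, 0 < ε → p j (T t x - S t x) ≤ ε * K := by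
    intro ε hε
    obtain ⟨δ, hδ, hδb⟩ := hclose j ε hε
    obtain ⟨n, hn⟩ := exists_nat_gt (|t| / δ)
    have hnpos : (0 : ℝ) < n := (div_pos htpos hδ).trans hn
    have habs : |t / n| = |t| / n := by rw [abs_div, Nat.abs_cast]
    have hle : |t / n| ≤ δ := by
      rw [habs, div_le_iff₀ hnpos, mul_comm]
      exact ((div_lt_iff₀ hδ).mp hn).le
    have hpos : 0 < |t / n| := by rw [habs]; positivity
    refine (seminorm_sub_le_of_step (p j) T S hT0 hS0 hTadd hSadd
      (mul_div_cancel₀ t hnpos.ne') hc (by positivity) hcb (hδb _ hpos hle) x).trans_eq ?_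
    rw [habs, hK]
    field_simp
  refine le_of_forall_pos_le_add fun η hη => ?_
  refine (small (η / (K + 1)) (by positivity)).trans ?_
  rw [zero_add, div_mul_eq_mul_div, div_le_iff₀ (by positivity)]
  nlinarith
end

section
/- (Failure of the Paley–Wiener growth bound when the degree is ≡ 2 mod 4.) Let a be a polynomial with complex coefficients whose natDegree m satisfies m % 4 = 2, and suppose (a.leadingCoeff).re ≠ 0. Then there do not exist R ≥ 0 and C ∈ ℝ such that (a.eval z).re ≤ R · |z.im| + C for all z ∈ ℂ. -/
open Polynomial in
/-- If `a` has degree at least `2` and its leading term has positive real part in the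
direction `w`, then `Re a` outgrows every affine function along the ray through `w`. -/
theorem Polynomial.exists_affine_lt_re_eval_mul (a : ℂ[X]) (w : ℂ) (hdeg : 2 ≤ a.natDegree)
    (hw : 0 < (a.leadingCoeff * w ^ a.natDegree).re) (R C : ℝ) :
    ∃ y : ℝ, 0 ≤ y ∧ R * y + C < (a.eval (y * w)).re := by
  set m := a.natDegree
  let P : ℝ[X] := ∑ k ∈ Finset.range (m + 1), Polynomial.C (a.coeff k * w ^ k).re * X ^ k
  have hP (y : ℝ) : P.eval y = (a.eval (y * w)).re := by
    rw [eval_eq_sum_range (p := a), Complex.re_sum, eval_finsetSum]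
    refine Finset.sum_congr rfl fun k _ ↦ ?_
    rw [eval_mul, eval_C, eval_pow, eval_X, ← Complex.re_mul_ofReal]
    push_cast
    ring_nf
  let Q : ℝ[X] := P - (Polynomial.C R * X + Polynomial.C C)
  have hcoeff : Q.coeff m = (a.leadingCoeff * w ^ m).re := by
    have h0 : m ≠ 0 := by lia
    have h1 : m ≠ 1 := by lia
    simp only [Q, P, coeff_sub, coeff_add, finsetSum_coeff, coeff_C_mul, coeff_X_pow, mul_ite,
      mul_one, mul_zero, add_zero, sub_zero,
      coeff_X_of_ne_one h1, coeff_C_of_ne_zero h0]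
    rw [Finset.sum_ite_eq, if_pos (Finset.self_mem_range_succ m)]
    rfl
  have hle : Q.natDegree ≤ m := by
    rw [← max_self m]
    refine natDegree_sub_le_of_le (natDegree_sum_le_of_forall_le _ _ fun k hk ↦ ?_) ?_
    · exact (natDegree_C_mul_X_pow_le _ _).trans (by simpa [Nat.lt_succ_iff] using hk)
    · exact natDegree_linear_le.trans (by lia)
  have hQm : Q.natDegree = m := natDegree_eq_of_le_of_coeff_ne_zero hle
    (by rw [hcoeff]; exact hw.ne')
  have htend := Q.tendsto_atTop_of_leadingCoeff_nonneg
    (natDegree_pos_iff_degree_pos.mp (by lia))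
    (by rw [Polynomial.leadingCoeff, hQm, hcoeff]; exact hw.le)
  obtain ⟨y, hy, hy0⟩ :=
    ((htend.eventually_gt_atTop 0).and (Filter.eventually_ge_atTop 0)).exists
  refine ⟨y, hy0, ?_⟩
  simp only [Q, eval_sub, hP, eval_add, eval_mul, eval_C, eval_X] at hy
  linarith

/-- Failure of the Paley–Wiener growth bound when the degree is
`≡ 2 mod 4`: if `natDegree a % 4 = 2` and the real part of the leading coefficient
is nonzero, then no bound `Re (a z) ≤ R * |Im z| + C` can hold on all of `ℂ`. -/
theorem stmt_13 (a : Polynomial ℂ) (hdeg : a.natDegree % 4 = 2)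
    (hlead : (a.leadingCoeff).re ≠ 0) :
    ¬ ∃ R : ℝ, 0 ≤ R ∧ ∃ C : ℝ, ∀ z : ℂ, (a.eval z).re ≤ R * |z.im| + C := by
  rintro ⟨R, -, C, h⟩
  have h2 : 2 ≤ a.natDegree := by lia
  rcases hlead.lt_or_gt with hneg | hpos
  · have hI : Complex.I ^ a.natDegree = -1 := by
      rw [Complex.I_pow_eq_pow_mod, hdeg, Complex.I_sq]
    obtain ⟨y, hy0, hy⟩ := a.exists_affine_lt_re_eval_mul Complex.I h2 (by simpa [hI]) R C
    have := h (y * Complex.I)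
    simp only [Complex.im_ofReal_mul, Complex.I_im, mul_one, abs_of_nonneg hy0] at this
    linarith
  · obtain ⟨y, -, hy⟩ := a.exists_affine_lt_re_eval_mul 1 h2 (by simpa) 0 C
    have := h (y * 1)
    simp only [Complex.im_ofReal_mul, Complex.one_im, mul_zero, abs_zero] at this
    linarith
end

section
/- (Failure of the Paley–Wiener growth bound for odd degree at least 3.) Let a be a polynomial with complex coefficients whose natDegree m is odd and satisfies m ≥ 3. Then there do not exist R ≥ 0 and C ∈ ℝ such that (a.eval z).re ≤ R · |z.im| + C for all z ∈ ℂ. -/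
open Polynomial Filter Bornology in
/-- A complex polynomial of degree at least two has no upper bound on its real part
that is affine in the norm. -/
theorem Polynomial.not_re_eval_le_mul_norm_add (a : ℂ[X]) (hdeg : 2 ≤ a.natDegree) (R C : ℝ) :
    ¬ ∀ z : ℂ, (a.eval z).re ≤ R * ‖z‖ + C := by
  intro h
  have ha : a ≠ 0 := by rintro rfl; simp at hdeg
  have hlc : a.leadingCoeff ≠ 0 := leadingCoeff_ne_zero.mpr ha
  obtain ⟨w, hw⟩ := IsAlgClosed.exists_pow_nat_eq a.leadingCoeff⁻¹ (by omega : 0 < a.natDegree)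
  have hw0 : w ≠ 0 := by
    rintro rfl
    rw [zero_pow (by omega)] at hw
    exact inv_ne_zero hlc hw.symm
  have small (q : ℂ[X]) (hq : q.degree < a.degree) : ∀ᶠ t : ℝ in atTop,
      ‖q.eval (t * w)‖ ≤ 1 / 4 * t ^ a.natDegree := by
    have hlim : Tendsto (fun t : ℝ => (t : ℂ) * w) atTop (cobounded ℂ) := by
      rw [← tendsto_norm_atTop_iff_cobounded]
      simp only [norm_mul, Complex.norm_real]
      exact tendsto_norm_atTop_atTop.atTop_mul_const (norm_pos_iff.mpr hw0)
    have hd : q.degree < (Polynomial.C a.leadingCoeff * X ^ a.natDegree).degree := by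
      rwa [degree_C_mul_X_pow _ hlc, ← degree_eq_natDegree ha]
    filter_upwards [hlim.eventually ((isLittleO_cobounded_of_degree_lt hd).def
      (by norm_num : (0 : ℝ) < 1 / 4)), eventually_ge_atTop 0] with t ht ht0
    have heq : a.leadingCoeff * ((t : ℂ) * w) ^ a.natDegree = (t : ℂ) ^ a.natDegree := by
      rw [mul_pow, hw]; field_simp
    simpa [heq, abs_of_nonneg ht0] using ht
  have hC : (Polynomial.C (C : ℂ)).degree < a.degree := by
    refine degree_C_le.trans_lt ?_
    rw [degree_eq_natDegree ha]
    exact_mod_cast (by omega : 0 < a.natDegree)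
  have hX : (Polynomial.C (R : ℂ) * X).degree < a.degree := by
    refine (degree_C_mul_X_le _).trans_lt ?_
    rw [degree_eq_natDegree ha]
    exact_mod_cast hdeg
  obtain ⟨t, h1, h2, h3, ht⟩ := ((small _ (degree_eraseLead_lt ha)).and
    ((small _ hC).and ((small _ hX).and (eventually_gt_atTop 0)))).exists
  have heq : a.eval (t * w) = a.eraseLead.eval (t * w) + ((t ^ a.natDegree : ℝ) : ℂ) := by
    conv_lhs => rw [← a.eraseLead_add_C_mul_X_pow]
    simp only [eval_add, eval_mul, eval_C, eval_pow, eval_X, mul_pow, hw]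
    push_cast
    field_simp
  have hz := h (t * w)
  rw [heq, Complex.add_re, Complex.ofReal_re] at hz
  have hre := neg_le_of_abs_le (Complex.abs_re_le_norm (a.eraseLead.eval (t * w)))
  rw [eval_C, Complex.norm_real, Real.norm_eq_abs] at h2
  rw [eval_mul, eval_C, eval_X, norm_mul, Complex.norm_real, Real.norm_eq_abs] at h3
  have hR := mul_le_mul_of_nonneg_right (le_abs_self R) (norm_nonneg ((t : ℂ) * w))
  have hpos : 0 < t ^ a.natDegree := pow_pos ht _
  linarith [le_abs_self C]

/-- Failure of the Paley–Wiener growth bound for odd degree at least 3: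
if `natDegree a` is odd and at least `3`, then no bound `Re (a z) ≤ R * |Im z| + C`
can hold on all of `ℂ`. -/
theorem stmt_14 (a : Polynomial ℂ) (hodd : Odd a.natDegree) (hdeg : 3 ≤ a.natDegree) :
    ¬ ∃ R : ℝ, 0 ≤ R ∧ ∃ C : ℝ, ∀ z : ℂ, (a.eval z).re ≤ R * |z.im| + C := by
  rintro ⟨R, hR, C, h⟩
  refine a.not_re_eval_le_mul_norm_add (by omega) R C fun z => (h z).trans ?_
  gcongr
  exact Complex.abs_im_le_norm z
end

section
/- (Translation formula for the exponential of d/dx.) Let f : ℝ → ℂ be of class C^∞ (ContDiff ℝ ⊤ f) and of exponential class. Then for all s, t ∈ ℝ, the series ∑ₙ (tⁿ/n!) • iteratedDeriv n f s converges with sum f(s + t); that is, HasSum (fun n => (tⁿ/n!) • iteratedDeriv n f s) (f (s + t)). -/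
/-- Lagrange-type bound for the remainder of a two-sided Taylor expansion, for a function
defined on the whole line. -/
theorem norm_sub_taylorWithinEval_univ_le {E : Type*} [NormedAddCommGroup E] [NormedSpace ℝ E]
    {f : ℝ → E} {n : ℕ} (hf : ContDiff ℝ (n + 1 : ℕ) f) {a x B : ℝ}
    (hB : ∀ y ∈ Set.uIcc a x, ‖iteratedDeriv (n + 1) f y‖ ≤ B) :
    ‖f x - taylorWithinEval f n Set.univ a x‖ ≤ B * |x - a| ^ (n + 1) / n.factorial := by
  have hderiv : ∀ y ∈ Set.uIcc a x,
      HasDerivWithinAt (fun u => taylorWithinEval f n Set.univ u x)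
        (((n.factorial : ℝ)⁻¹ * (x - y) ^ n) • iteratedDeriv (n + 1) f y) (Set.uIcc a x) y := by
    intro y _
    have hdiff : Differentiable ℝ (iteratedDeriv n f) :=
      hf.differentiable_iteratedDeriv n (by exact_mod_cast n.lt_succ_self)
    have h := hasDerivWithinAt_taylorWithinEval (x := x) (y := y) (n := n) (f := f)
      uniqueDiffOn_univ (Filter.univ_mem) (Set.mem_univ y) subset_rfl
      (hf.of_le (by exact_mod_cast n.le_succ)).contDiffOn
      (by rw [iteratedDerivWithin_univ]; exact (hdiff y).differentiableWithinAt)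
    rw [iteratedDerivWithin_univ] at h
    exact h.mono (Set.subset_univ _)
  have hbound : ∀ y ∈ Set.uIcc a x,
      ‖((n.factorial : ℝ)⁻¹ * (x - y) ^ n) • iteratedDeriv (n + 1) f y‖
        ≤ (n.factorial : ℝ)⁻¹ * |x - a| ^ n * B := by
    intro y hy
    rw [norm_smul, norm_mul, norm_inv, norm_pow, Real.norm_natCast, Real.norm_eq_abs]
    have hxy : |x - y| ≤ |x - a| := Set.abs_sub_right_of_mem_uIcc hy
    have hBy := hB y hy
    gcongr ?_ * ?_ ^ n * ?_
  have h := (convex_uIcc a x).norm_image_sub_le_of_norm_hasDerivWithin_le hderiv hbound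
    Set.left_mem_uIcc Set.right_mem_uIcc
  rw [taylorWithinEval_self, Real.norm_eq_abs] at h
  refine h.trans_eq ?_
  ring

/-- Translation formula for the exponential of `d/dx`: for a `C^∞`
function `f : ℝ → ℂ` of exponential class, the series `∑ₙ (tⁿ/n!) • f⁽ⁿ⁾(s)` converges
with sum `f (s + t)`. -/
theorem stmt_16 (f : ℝ → ℂ) (hf : ContDiff ℝ (⊤ : ℕ∞) f)
    (hexp : ∀ r : ℝ, 0 < r → ∃ C : ℝ, 0 < C ∧ ∃ M : ℝ, 0 < M ∧
      ∀ (n : ℕ) (x : ℝ), |x| ≤ r → ‖iteratedDeriv n f x‖ ≤ C * M ^ n) :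
    ∀ s t : ℝ,
      HasSum (fun n : ℕ => (t ^ n / n.factorial : ℝ) • iteratedDeriv n f s)
        (f (s + t)) := by
  intro s t
  obtain ⟨C, hC, M, hM, hbd⟩ := hexp (|s| + |t| + 1) (by positivity)
  have hsum : Summable fun n : ℕ => (t ^ n / n.factorial : ℝ) • iteratedDeriv n f s := by
    refine Summable.of_norm_bounded ((Real.summable_pow_div_factorial (|t| * M)).mul_left C) ?_
    intro n
    have hs := hbd n s (by linarith [abs_nonneg t])
    rw [norm_smul, norm_div, norm_pow, Real.norm_natCast, Real.norm_eq_abs]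
    calc |t| ^ n / n.factorial * ‖iteratedDeriv n f s‖
        ≤ |t| ^ n / n.factorial * (C * M ^ n) := by gcongr
      _ = C * ((|t| * M) ^ n / n.factorial) := by ring
  rw [hsum.hasSum_iff_tendsto_nat, ← Filter.tendsto_add_atTop_iff_nat 1]
  have hpartial : ∀ n : ℕ,
      ∑ i ∈ Finset.range (n + 1), (t ^ i / i.factorial : ℝ) • iteratedDeriv i f s
        = taylorWithinEval f n Set.univ s (s + t) := by
    intro n
    rw [taylor_within_apply]
    refine Finset.sum_congr rfl fun i _ => ?_
    rw [iteratedDerivWithin_univ, add_sub_cancel_left, div_eq_inv_mul]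
  simp_rw [hpartial]
  rw [tendsto_iff_norm_sub_tendsto_zero]
  have hlim := (FloorSemiring.tendsto_pow_div_factorial_atTop (M * |t|)).const_mul (C * (M * |t|))
  rw [mul_zero] at hlim
  refine squeeze_zero (fun _ => norm_nonneg _) (fun n => ?_) hlim
  rw [norm_sub_rev]
  refine (norm_sub_taylorWithinEval_univ_le (B := C * M ^ (n + 1))
    (hf.of_le (by exact_mod_cast le_top)) fun y hy => hbd _ y ?_).trans_eq ?_
  · have h₁ := Set.abs_sub_left_of_mem_uIcc hy
    have h₂ := abs_add_le s (y - s)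
    simp only [add_sub_cancel, add_sub_cancel_left] at h₁ h₂
    linarith
  · rw [add_sub_cancel_left]
    ring
end

section
/- (Density of the exponential class in C^∞(ℝ).) Let g : ℝ → ℂ be of class C^∞ (ContDiff ℝ ⊤ g). Then for every ε > 0, every m ∈ ℕ and every r > 0 there exists a function f : ℝ → ℂ of class C^∞ and of exponential class such that ‖iteratedDeriv k f x − iteratedDeriv k g x‖ ≤ ε for every k ≤ m and every x ∈ ℝ with |x| ≤ r. (That is, C^∞_exp is dense in C^∞(ℝ, ℂ) for the topology of uniform convergence of all derivatives on compact sets.) -/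
open Polynomial

theorem exists_derivative_eq (q : ℂ[X]) : ∃ p : ℂ[X], derivative p = q := by
  induction q using Polynomial.induction_on' with
  | add p q hp hq =>
    obtain ⟨a, rfl⟩ := hp
    obtain ⟨b, rfl⟩ := hq
    exact ⟨a + b, derivative_add⟩
  | monomial n a =>
    refine ⟨monomial (n + 1) (a / (n + 1)), ?_⟩
    have : (n + 1 : ℂ) ≠ 0 := by exact_mod_cast n.succ_ne_zero
    rw [derivative_monomial]
    push_cast
    rw [div_mul_cancel₀ _ this]

theorem hasDerivAt_eval_ofReal (p : ℂ[X]) (x : ℝ) :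
    HasDerivAt (fun y : ℝ => p.eval (y : ℂ)) ((derivative p).eval (x : ℂ)) x :=
  (p.hasDerivAt (x : ℂ)).comp_ofReal

theorem iteratedDeriv_eval_ofReal (p : ℂ[X]) (n : ℕ) :
    iteratedDeriv n (fun x : ℝ => p.eval (x : ℂ)) =
      fun x : ℝ => (derivative^[n] p).eval (x : ℂ) := by
  induction n with
  | zero => simp
  | succ n ih =>
    rw [iteratedDeriv_succ, ih, Function.iterate_succ_apply']
    exact funext fun x => (hasDerivAt_eval_ofReal _ x).deriv

theorem continuous_eval_ofReal (p : ℂ[X]) : Continuous fun x : ℝ => p.eval (x : ℂ) :=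
  p.continuous.comp Complex.continuous_ofReal

theorem contDiff_eval_ofReal (p : ℂ[X]) {n : ℕ∞} :
    ContDiff ℝ n fun x : ℝ => p.eval (x : ℂ) := by
  refine contDiff_of_differentiable_iteratedDeriv fun m _ => ?_
  rw [iteratedDeriv_eval_ofReal]
  exact fun x => (hasDerivAt_eval_ofReal _ x).differentiableAt

theorem exists_bound_iteratedDeriv_eval_ofReal (p : ℂ[X]) (r : ℝ) :
    ∃ C : ℝ, 0 < C ∧ ∀ (n : ℕ) (x : ℝ), |x| ≤ r →
      ‖iteratedDeriv n (fun x : ℝ => p.eval (x : ℂ)) x‖ ≤ C := by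
  let S : ℝ → ℝ := fun x =>
    ∑ n ∈ Finset.range (p.natDegree + 1), ‖(derivative^[n] p).eval (x : ℂ)‖
  have hS : Continuous S :=
    continuous_finsetSum _ fun n _ => (continuous_eval_ofReal _).norm
  obtain ⟨C, hC⟩ := (isCompact_Icc (a := -r) (b := r)).exists_bound_of_continuousOn hS.continuousOn
  refine ⟨max C 1, by positivity, fun n x hx => ?_⟩
  rw [iteratedDeriv_eval_ofReal]
  by_cases hn : n < p.natDegree + 1
  · calc ‖(derivative^[n] p).eval (x : ℂ)‖ ≤ S x :=
          Finset.single_le_sum (f := fun n => ‖(derivative^[n] p).eval (x : ℂ)‖)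
            (fun _ _ => norm_nonneg _) (Finset.mem_range.2 hn)
      _ ≤ ‖S x‖ := Real.le_norm_self _
      _ ≤ C := hC x (abs_le.1 hx)
      _ ≤ max C 1 := le_max_left _ _
  · simp [iterate_derivative_eq_zero (show p.natDegree < n by omega)]

theorem exists_complex_polynomial_near {g : ℝ → ℂ} (hg : Continuous g) (r : ℝ) {ε : ℝ}
    (hε : 0 < ε) : ∃ p : ℂ[X], ∀ x : ℝ, |x| ≤ r → ‖p.eval (x : ℂ) - g x‖ ≤ ε := by
  obtain ⟨a, ha⟩ := exists_polynomial_near_of_continuousOn (-r) r (fun x => (g x).re)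
    (Complex.continuous_re.comp hg).continuousOn (ε / 2) (by positivity)
  obtain ⟨b, hb⟩ := exists_polynomial_near_of_continuousOn (-r) r (fun x => (g x).im)
    (Complex.continuous_im.comp hg).continuousOn (ε / 2) (by positivity)
  refine ⟨a.map Complex.ofRealHom + C Complex.I * b.map Complex.ofRealHom, fun x hx => ?_⟩
  have hmap (q : ℝ[X]) : (q.map Complex.ofRealHom).eval (x : ℂ) = (q.eval x : ℝ) :=
    eval_map_apply Complex.ofRealHom x
  refine (Complex.norm_le_abs_re_add_abs_im _).trans ?_
  have h1 := ha x (abs_le.1 hx)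
  have h2 := hb x (abs_le.1 hx)
  simp only [eval_add, eval_mul, eval_C, hmap, Complex.sub_re, Complex.add_re, Complex.mul_re,
    Complex.ofReal_re, Complex.I_re, Complex.I_im, Complex.ofReal_im, Complex.sub_im,
    Complex.add_im, Complex.mul_im, zero_mul, one_mul, sub_zero, add_zero, zero_add]
  linarith

theorem exists_polynomial_iteratedDeriv_near (m : ℕ) {r : ℝ} (hr : 0 < r) :
    ∀ {g : ℝ → ℂ}, ContDiff ℝ m g → ∀ {ε : ℝ}, 0 < ε → ∃ p : ℂ[X], ∀ k ≤ m, ∀ x : ℝ, |x| ≤ r →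
      ‖(derivative^[k] p).eval (x : ℂ) - iteratedDeriv k g x‖ ≤ ε := by
  induction m with
  | zero =>
    intro g hg ε hε
    obtain ⟨p, hp⟩ := exists_complex_polynomial_near hg.continuous r hε
    refine ⟨p, fun k hk x hx => ?_⟩
    obtain rfl := Nat.le_zero.1 hk
    simpa using hp x hx
  | succ m ih =>
    intro g hg ε hε
    have hg' : ContDiff ℝ (m + 1) g := by exact_mod_cast hg
    obtain ⟨hd, -, hg''⟩ := contDiff_succ_iff_deriv.1 hg'
    obtain ⟨q, hq⟩ := ih hg'' (ε := min ε (ε / r)) (by positivity)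
    obtain ⟨P, rfl⟩ := exists_derivative_eq q
    refine ⟨P + C (g 0 - P.eval 0), fun k hk x hx => ?_⟩
    cases k with
    | succ k =>
      rw [Function.iterate_succ_apply, iteratedDeriv_succ', derivative_add, derivative_C, add_zero]
      exact (hq k (by omega) x hx).trans (min_le_left _ _)
    | zero =>
      have hmv := (convex_Icc (-r) r).norm_image_sub_le_of_norm_hasDerivWithin_le
        (f := fun y : ℝ => P.eval (y : ℂ) - g y) (x := 0) (y := x) (C := ε / r)
        (fun y _ => ((hasDerivAt_eval_ofReal P y).sub (hd y).hasDerivAt).hasDerivWithinAt)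
        (fun y hy => by simpa using (hq 0 (Nat.zero_le _) y (abs_le.2 hy)).trans (min_le_right _ _))
        ⟨by linarith, hr.le⟩ (abs_le.1 hx)
      calc _ = ‖(P.eval (x : ℂ) - g x) - (P.eval ((0 : ℝ) : ℂ) - g 0)‖ := by
            simp; congr 1; ring
        _ ≤ ε / r * ‖x - 0‖ := hmv
        _ ≤ ε / r * r := by rw [sub_zero, Real.norm_eq_abs]; gcongr
        _ = ε := div_mul_cancel₀ _ hr.ne'

/-- Density of the exponential class in `C^∞(ℝ)`: every `C^∞` function
`g : ℝ → ℂ` can be approximated, uniformly with all derivatives up to any fixed order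
on any compact interval `[-r, r]`, by `C^∞` functions of exponential class. -/
theorem stmt_17 (g : ℝ → ℂ) (hg : ContDiff ℝ (⊤ : ℕ∞) g) :
    ∀ ε : ℝ, 0 < ε → ∀ m : ℕ, ∀ r : ℝ, 0 < r →
      ∃ f : ℝ → ℂ, ContDiff ℝ (⊤ : ℕ∞) f ∧
        (∀ r' : ℝ, 0 < r' → ∃ C : ℝ, 0 < C ∧ ∃ M : ℝ, 0 < M ∧
          ∀ (n : ℕ) (x : ℝ), |x| ≤ r' → ‖iteratedDeriv n f x‖ ≤ C * M ^ n) ∧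
        ∀ k : ℕ, k ≤ m → ∀ x : ℝ, |x| ≤ r →
          ‖iteratedDeriv k f x - iteratedDeriv k g x‖ ≤ ε := by
  intro ε hε m r hr
  obtain ⟨p, hp⟩ := exists_polynomial_iteratedDeriv_near m hr
    (hg.of_le (by exact_mod_cast le_top)) hε
  refine ⟨fun x => p.eval (x : ℂ), contDiff_eval_ofReal p, fun r' _ => ?_, fun k hk x hx => ?_⟩
  · obtain ⟨C, hC, hbound⟩ := exists_bound_iteratedDeriv_eval_ofReal p r'
    exact ⟨C, hC, 1, one_pos, fun n x hx => by simpa using hbound n x hx⟩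
  · rw [iteratedDeriv_eval_ofReal]
    exact hp k hk x hx
end

section
/- (The exponential class is stable under convolution with test functions.) Let f : ℝ → ℂ be of class C^∞ (ContDiff ℝ ⊤ f) and of exponential class, and let g : ℝ → ℂ be of class C^∞ with compact support (HasCompactSupport g). Then the convolution f ⋆ g with respect to Lebesgue measure, (f ⋆ g)(x) = ∫ f(x − y) g(y) dy, is of class C^∞ and of exponential class. -/
open MeasureTheory
open scoped Convolution

theorem integral_sub_mul_eq_convolution (f g : ℝ → ℂ) :
    (fun x : ℝ => ∫ y : ℝ, f (x - y) * g y) = g ⋆[ContinuousLinearMap.mul ℝ ℂ] f := by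
  ext x
  simp only [convolution_def, ContinuousLinearMap.mul_apply', mul_comm]

theorem integrable_sub_mul {f g : ℝ → ℂ} (hf : Continuous f) (hg : Continuous g)
    (hgsupp : HasCompactSupport g) (x : ℝ) : Integrable (fun y : ℝ => f (x - y) * g y) :=
  Continuous.integrable_of_hasCompactSupport (by fun_prop) hgsupp.mul_left

theorem integral_sub_mul_deriv {f g : ℝ → ℂ} (hf : ContDiff ℝ 1 f) (hg : ContDiff ℝ 1 g)
    (hgsupp : HasCompactSupport g) (x : ℝ) :
    ∫ y : ℝ, f (x - y) * deriv g y = ∫ y : ℝ, deriv f (x - y) * g y := by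
  have hf' : ∀ y, HasDerivAt (fun y => f (x - y)) (-deriv f (x - y)) y := fun y => by
    simpa using (hf.differentiable one_ne_zero (x - y)).hasDerivAt.comp_const_sub x y
  have hdf : Continuous (deriv f) := hf.continuous_deriv le_rfl
  have h := integral_mul_deriv_eq_deriv_mul_of_integrable
    (fun y _ => hf' y) (fun y _ => (hg.differentiable one_ne_zero y).hasDerivAt)
    (integrable_sub_mul hf.continuous (hg.continuous_deriv le_rfl) hgsupp.deriv x)
    ((integrable_sub_mul hdf hg.continuous hgsupp x).neg.congr
      (.of_forall fun y => (neg_mul _ _).symm))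
    (integrable_sub_mul hf.continuous hg.continuous hgsupp x)
  simpa [integral_neg] using h

theorem deriv_integral_sub_mul {f g : ℝ → ℂ} (hf : ContDiff ℝ 1 f) (hg : ContDiff ℝ 1 g)
    (hgsupp : HasCompactSupport g) :
    deriv (fun x : ℝ => ∫ y : ℝ, f (x - y) * g y) =
      fun x : ℝ => ∫ y : ℝ, deriv f (x - y) * g y := by
  ext x
  rw [← integral_sub_mul_deriv hf hg hgsupp, integral_sub_mul_eq_convolution]
  rw [(hgsupp.hasDerivAt_convolution_left (ContinuousLinearMap.mul ℝ ℂ) hg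
    hf.continuous.locallyIntegrable x).deriv]
  exact (congrFun (integral_sub_mul_eq_convolution f (deriv g)) x).symm

theorem iteratedDeriv_integral_sub_mul {f g : ℝ → ℂ} (hf : ContDiff ℝ (⊤ : ℕ∞) f)
    (hg : ContDiff ℝ 1 g) (hgsupp : HasCompactSupport g) (n : ℕ) :
    iteratedDeriv n (fun x : ℝ => ∫ y : ℝ, f (x - y) * g y) =
      fun x : ℝ => ∫ y : ℝ, iteratedDeriv n f (x - y) * g y := by
  induction n with
  | zero => simp
  | succ n ih =>
    have hfn : ContDiff ℝ 1 (iteratedDeriv n f) := by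
      rw [iteratedDeriv_eq_iterate]
      exact (hf.iterate_deriv n).of_le (mod_cast le_top)
    rw [iteratedDeriv_succ, ih, deriv_integral_sub_mul hfn hg hgsupp, iteratedDeriv_succ]

theorem norm_integral_sub_mul_le {f g : ℝ → ℂ} (hg : Continuous g)
    (hgsupp : HasCompactSupport g) {K x : ℝ}
    (hK : ∀ y ∈ Function.support g, ‖f (x - y)‖ ≤ K) :
    ‖∫ y : ℝ, f (x - y) * g y‖ ≤ K * ∫ y : ℝ, ‖g y‖ := by
  rw [← integral_const_mul]
  refine norm_integral_le_of_norm_le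
    ((hg.integrable_of_hasCompactSupport hgsupp).norm.const_mul K) (.of_forall fun y => ?_)
  by_cases hy : g y = 0
  · simp [hy]
  · rw [norm_mul]
    gcongr
    exact hK y hy

/-- The exponential class is stable under convolution with test
functions: if `f : ℝ → ℂ` is `C^∞` of exponential class and `g : ℝ → ℂ` is `C^∞`
with compact support, then `x ↦ ∫ f (x - y) * g y dy` is `C^∞` of exponential class. -/
theorem stmt_18 (f g : ℝ → ℂ) (hf : ContDiff ℝ (⊤ : ℕ∞) f)
    (hfexp : ∀ r : ℝ, 0 < r → ∃ C : ℝ, 0 < C ∧ ∃ M : ℝ, 0 < M ∧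
      ∀ (n : ℕ) (x : ℝ), |x| ≤ r → ‖iteratedDeriv n f x‖ ≤ C * M ^ n)
    (hg : ContDiff ℝ (⊤ : ℕ∞) g) (hgsupp : HasCompactSupport g) :
    ContDiff ℝ (⊤ : ℕ∞) (fun x : ℝ => ∫ y : ℝ, f (x - y) * g y) ∧
    (∀ r : ℝ, 0 < r → ∃ C : ℝ, 0 < C ∧ ∃ M : ℝ, 0 < M ∧
      ∀ (n : ℕ) (x : ℝ), |x| ≤ r →
        ‖iteratedDeriv n (fun x : ℝ => ∫ y : ℝ, f (x - y) * g y) x‖ ≤ C * M ^ n) := by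
  have hg1 : ContDiff ℝ 1 g := hg.of_le (mod_cast le_top)
  refine ⟨?_, fun r hr => ?_⟩
  · rw [integral_sub_mul_eq_convolution]
    exact hgsupp.contDiff_convolution_left _ hg hf.continuous.locallyIntegrable
  · obtain ⟨R, hR, hgR⟩ := hgsupp.isBounded.exists_pos_norm_le
    obtain ⟨C, hC, M, hM, hfCM⟩ := hfexp (r + R) (by positivity)
    have hI : 0 ≤ ∫ y : ℝ, ‖g y‖ := integral_nonneg fun y => norm_nonneg _
    refine ⟨C * ((∫ y : ℝ, ‖g y‖) + 1), by positivity, M, hM, fun n x hx => ?_⟩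
    rw [iteratedDeriv_integral_sub_mul hf hg1 hgsupp]
    calc
      _ ≤ C * M ^ n * ∫ y : ℝ, ‖g y‖ := by
        refine norm_integral_sub_mul_le hg.continuous hgsupp fun y hy => hfCM n _ ?_
        exact (abs_sub x y).trans (add_le_add hx (hgR y (subset_tsupport g hy)))
      _ ≤ C * M ^ n * ((∫ y : ℝ, ‖g y‖) + 1) := by gcongr; simp
      _ = _ := by ring
end
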